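/- Let d ≥ 1, let μ be the Haar probability measure on the compact group U(d) of d×d complex unitary matrices, and define x₂(s,t) = d if s = t and −1 otherwise. Let X be the diagonal matrix indexed by (Fin d)³ whose diagonal entry at (s₁,s₂,s₃) equals x₂(s₁,s₂)·x₂(s₁,s₃). For each permutation π of {1,2,3}, let P_π be the permutation operator on (ℂ^d)^{⊗3} with entries (P_π)_{a,b} = 1 if a_{π(k)} = b_k for all k, and 0 otherwise. Then ∫ U^{⊗3} X (U^{⊗3})† dμ(U) = −(1/(d+2))·(P_id + P_(12) + P_(13)) + ((d+1)/(d+2))·(P_(23) + P_(123) + P_(132)). -/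

import Mathlib

open MeasureTheory Matrix

noncomputable instance {d : ℕ} : MeasurableSpace (Matrix (Fin d) (Fin d) ℂ) := borel _
instance {d : ℕ} : BorelSpace (Matrix (Fin d) (Fin d) ℂ) := ⟨rfl⟩

/-- The 3-fold tensor (Kronecker) power of a square matrix, indexed by triples. -/
noncomputable def tpow3 {d : ℕ} (A : Matrix (Fin d) (Fin d) ℂ) :
    Matrix (Fin 3 → Fin d) (Fin 3 → Fin d) ℂ :=
  Matrix.of fun a b => ∏ k, A (a k) (b k)

/-- The permutation operator `P_π` on the 3-fold tensor power:
`(P_π)_{a,b} = 1` if `a (π k) = b k` for all `k`, else `0`. -/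
noncomputable def permOp3 {d : ℕ} (π : Equiv.Perm (Fin 3)) :
    Matrix (Fin 3 → Fin d) (Fin 3 → Fin d) ℂ :=
  Matrix.of fun a b => if ∀ k, a (π k) = b k then 1 else 0

/-- The purity post-processing coefficient: `d` on the diagonal and `−1` off the diagonal. -/
noncomputable def x2coef (d : ℕ) (s t : Fin d) : ℂ := if s = t then (d : ℂ) else -1

section ColumnMoments

variable {d : ℕ}

theorem continuous_unitaryGroup_entry (i j : Fin d) :
    Continuous fun U : Matrix.unitaryGroup (Fin d) ℂ => (U : Matrix (Fin d) (Fin d) ℂ) i j :=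
  (continuous_apply_apply i j).comp continuous_subtype_val

theorem isCompact_unitaryGroup :
    IsCompact (Matrix.unitaryGroup (Fin d) ℂ : Set (Matrix (Fin d) (Fin d) ℂ)) := by
  refine IsCompact.of_isClosed_subset
    (isCompact_univ_pi fun _ => isCompact_univ_pi fun _ => isCompact_closedBall (0 : ℂ) 1)
    isClosed_unitary fun U hU i _ j _ => ?_
  simpa using entry_norm_bound_of_unitary hU i j

instance : CompactSpace (Matrix.unitaryGroup (Fin d) ℂ) :=
  isCompact_iff_compactSpace.mp isCompact_unitaryGroup

theorem Continuous.integrable_unitaryGroup {E : Type*} [NormedAddCommGroup E]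
    {μ : Measure (Matrix.unitaryGroup (Fin d) ℂ)} [IsFiniteMeasure μ]
    {f : Matrix.unitaryGroup (Fin d) ℂ → E} (hf : Continuous f) : Integrable f μ :=
  hf.integrable_of_hasCompactSupport (HasCompactSupport.of_compactSpace f)

theorem one_sub_smul_vecMulVec_mem_unitaryGroup (w : Fin d → ℂ) (c : ℝ)
    (h : (c : ℂ) * (star w ⬝ᵥ w) = 2) :
    1 - (c : ℂ) • vecMulVec w (star w) ∈ Matrix.unitaryGroup (Fin d) ℂ := by
  have hstar : star (1 - (c : ℂ) • vecMulVec w (star w)) = 1 - (c : ℂ) • vecMulVec w (star w) := by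
    ext i j
    simp [Matrix.star_apply, vecMulVec_apply, Matrix.one_apply, eq_comm, apply_ite, mul_comm]
  have hsq : vecMulVec w (star w) * vecMulVec w (star w)
      = (star w ⬝ᵥ w) • vecMulVec w (star w) := by
    rw [vecMulVec_mul_vecMulVec, vecMulVec_smul]
  rw [Matrix.mem_unitaryGroup_iff, hstar]
  simp only [mul_sub, sub_mul, mul_one, one_mul, Matrix.smul_mul, Matrix.mul_smul, hsq, smul_smul]
  have : (c : ℂ) * (c * (star w ⬝ᵥ w)) = c + c := by rw [h]; ring
  rw [this, add_smul]
  abel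

/-- The reflection along `e_p + β e_q`, described by its action on the columns of a matrix. -/
theorem exists_unitary_reflection {p q : Fin d} (hpq : p ≠ q) (β : ℂ) (c : ℝ)
    (h : c * (1 + Complex.normSq β) = 2) :
    ∃ V : Matrix.unitaryGroup (Fin d) ℂ, ∀ (U : Matrix.unitaryGroup (Fin d) ℂ) (s : Fin d),
      (V * U).1 p s = U.1 p s - c * (U.1 p s + star β * U.1 q s) ∧
      (V * U).1 q s = U.1 q s - c * β * (U.1 p s + star β * U.1 q s) ∧
      ∀ r, r ≠ p → r ≠ q → (V * U).1 r s = U.1 r s := by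
  let w : Fin d → ℂ := Pi.single p 1 + Pi.single q β
  have hw : (c : ℂ) * (star w ⬝ᵥ w) = 2 := by
    have : star w ⬝ᵥ w = 1 + (Complex.normSq β : ℂ) := by
      simp [w, Pi.star_single, hpq, hpq.symm, Complex.normSq_eq_conj_mul_self]
    rw [this]
    exact_mod_cast h
  have key (U : Matrix.unitaryGroup (Fin d) ℂ) (r s : Fin d) :
      ((1 - (c : ℂ) • vecMulVec w (star w)) * U.1) r s
        = U.1 r s - c * w r * (U.1 p s + star β * U.1 q s) := by
    have : star w ᵥ* U.1 = fun s => U.1 p s + star β * U.1 q s := by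
      ext s
      simp [w, Pi.star_single, Matrix.add_vecMul]
    rw [Matrix.sub_mul, Matrix.one_mul, Matrix.smul_mul, vecMulVec_mul, this]
    simp [vecMulVec_apply, mul_assoc]
  refine ⟨⟨_, one_sub_smul_vecMulVec_mem_unitaryGroup w c hw⟩, fun U s => ⟨?_, ?_, ?_⟩⟩
  · simpa [w, hpq] using key U p s
  · simpa [w, hpq, hpq.symm] using key U q s
  · intro r hp hq
    simpa [w, hp, hq] using key U r s

variable (μ : Measure (Matrix.unitaryGroup (Fin d) ℂ))

theorem integral_eq_of_swap [μ.IsMulLeftInvariant] {p q : Fin d} (hpq : p ≠ q) (s : Fin d)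
    (f : ℂ → ℂ → ℝ) :
    ∫ U, f (U.1 p s) (U.1 q s) ∂μ = ∫ U, f (U.1 q s) (U.1 p s) ∂μ := by
  obtain ⟨V, hV⟩ := exists_unitary_reflection hpq (-1) 1 (by norm_num)
  rw [← integral_mul_left_eq_self _ V]
  refine integral_congr_ae (.of_forall fun U => ?_)
  obtain ⟨h1, h2, -⟩ := hV U s
  simp only [h1, h2]
  congr 1 <;> simp

theorem integral_normSq_pow_mul_eq_of_rotation [μ.IsMulLeftInvariant]
    {p q : Fin d} (hpq : p ≠ q) (s : Fin d) (n : ℕ) (g : Matrix.unitaryGroup (Fin d) ℂ → ℝ)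
    (hg : ∀ U V, (∀ r, r ≠ p → r ≠ q → (V * U).1 r s = U.1 r s) → g (V * U) = g U)
    {ω : ℂ} (hω : Complex.normSq ω = 1) :
    ∫ U, Complex.normSq (U.1 p s) ^ n * g U ∂μ
      = ∫ U, Complex.normSq ((3 * U.1 p s - 4 * ω * U.1 q s) / 5) ^ n * g U ∂μ := by
  obtain ⟨V, hV⟩ := exists_unitary_reflection hpq (2 * star ω) (2 / 5) (by
    simp only [Complex.normSq_mul, Complex.star_def, Complex.normSq_conj, hω]
    norm_num)
  rw [← integral_mul_left_eq_self _ V]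
  refine integral_congr_ae (.of_forall fun U => ?_)
  obtain ⟨h1, -, h2⟩ := hV U s
  simp only [h1, hg U V h2]
  congr 3
  simp
  ring

theorem integral_normSq_pow_mul_eq_average [μ.IsMulLeftInvariant] [IsFiniteMeasure μ]
    {p q : Fin d} (hpq : p ≠ q) (s : Fin d) (n : ℕ) {g : Matrix.unitaryGroup (Fin d) ℂ → ℝ}
    (hgc : Continuous g)
    (hg : ∀ U V, (∀ r, r ≠ p → r ≠ q → (V * U).1 r s = U.1 r s) → g (V * U) = g U) :
    4 * ∫ U, Complex.normSq (U.1 p s) ^ n * g U ∂μ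
      = ∫ U, (Complex.normSq ((3 * U.1 p s - 4 * 1 * U.1 q s) / 5) ^ n
          + Complex.normSq ((3 * U.1 p s - 4 * (-1) * U.1 q s) / 5) ^ n
          + Complex.normSq ((3 * U.1 p s - 4 * Complex.I * U.1 q s) / 5) ^ n
          + Complex.normSq ((3 * U.1 p s - 4 * (-Complex.I) * U.1 q s) / 5) ^ n) * g U ∂μ := by
  have hint (ω : ℂ) : Integrable (fun U : Matrix.unitaryGroup (Fin d) ℂ =>
      Complex.normSq ((3 * U.1 p s - 4 * ω * U.1 q s) / 5) ^ n * g U) μ := by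
    have hp := continuous_unitaryGroup_entry p s
    have hq := continuous_unitaryGroup_entry q s
    refine Continuous.integrable_unitaryGroup (.mul (.pow ?_ n) hgc)
    exact Complex.continuous_normSq.comp
      (((continuous_const.mul hp).sub (continuous_const.mul hq)).div_const 5)
  simp only [add_mul]
  rw [integral_add (((hint _).fun_add (hint _)).fun_add (hint _)) (hint _),
    integral_add ((hint _).fun_add (hint _)) (hint _), integral_add (hint _) (hint _)]
  simp only [← integral_normSq_pow_mul_eq_of_rotation μ hpq s n g hg, map_one, Complex.normSq_neg,
    Complex.normSq_I]
  ring

theorem integral_normSq_pow_three_eq [μ.IsMulLeftInvariant] [IsFiniteMeasure μ]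
    {p q : Fin d} (hpq : p ≠ q) (s : Fin d) :
    ∫ U, Complex.normSq (U.1 p s) ^ 3 ∂μ
      = 3 * ∫ U, Complex.normSq (U.1 p s) ^ 2 * Complex.normSq (U.1 q s) ∂μ := by
  have h := integral_normSq_pow_mul_eq_average μ hpq s 3 (g := fun _ => 1) continuous_const
    (fun _ _ _ => rfl)
  have hpt (x y : ℂ) : (Complex.normSq ((3 * x - 4 * 1 * y) / 5) ^ 3
      + Complex.normSq ((3 * x - 4 * (-1) * y) / 5) ^ 3
      + Complex.normSq ((3 * x - 4 * Complex.I * y) / 5) ^ 3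
      + Complex.normSq ((3 * x - 4 * (-Complex.I) * y) / 5) ^ 3) * 1
      = 4 / 15625 * 729 * Complex.normSq x ^ 3
        + 4 / 15625 * 11664 * (Complex.normSq x ^ 2 * Complex.normSq y)
        + 4 / 15625 * 20736 * (Complex.normSq y ^ 2 * Complex.normSq x)
        + 4 / 15625 * 4096 * Complex.normSq y ^ 3 := by
    simp [Complex.normSq_apply]
    ring
  have hint (a b : ℕ) (r t : Fin d) (c : ℝ) : Integrable (fun U : Matrix.unitaryGroup (Fin d) ℂ =>
      c * (Complex.normSq (U.1 r s) ^ a * Complex.normSq (U.1 t s) ^ b)) μ := by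
    have hp := Complex.continuous_normSq.comp (continuous_unitaryGroup_entry r s)
    have hq := Complex.continuous_normSq.comp (continuous_unitaryGroup_entry t s)
    exact Continuous.integrable_unitaryGroup (continuous_const.mul ((hp.pow a).mul (hq.pow b)))
  have h3 (r : Fin d) (c : ℝ) := by simpa using hint 3 0 r r c
  have h21 (r t : Fin d) (c : ℝ) := by simpa using hint 2 1 r t c
  simp only [hpt] at h
  rw [integral_add (((h3 _ _).fun_add (h21 _ _ _)).fun_add (h21 _ _ _)) (h3 _ _),
    integral_add ((h3 _ _).fun_add (h21 _ _ _)) (h21 _ _ _), integral_add (h3 _ _) (h21 _ _ _)] at h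
  simp only [integral_const_mul, mul_one] at h
  have e3 := integral_eq_of_swap μ hpq s fun x _ => Complex.normSq x ^ 3
  have e21 := integral_eq_of_swap μ hpq s fun x y => Complex.normSq x ^ 2 * Complex.normSq y
  rw [← e3, ← e21] at h
  linarith

theorem integral_normSq_sq_mul_eq [μ.IsMulLeftInvariant] [IsFiniteMeasure μ]
    {p q r : Fin d} (hpq : p ≠ q) (hpr : p ≠ r) (hqr : q ≠ r) (s : Fin d) :
    ∫ U, Complex.normSq (U.1 p s) ^ 2 * Complex.normSq (U.1 r s) ∂μ
      = 2 * ∫ U, Complex.normSq (U.1 p s) * Complex.normSq (U.1 q s)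
          * Complex.normSq (U.1 r s) ∂μ := by
  have hc (i : Fin d) := Complex.continuous_normSq.comp (continuous_unitaryGroup_entry i s)
  have h := integral_normSq_pow_mul_eq_average μ hpq s 2 (hc r)
    (fun U V hV => by simp [hV r hpr.symm hqr.symm])
  have hpt (x y : ℂ) (z : ℝ) : (Complex.normSq ((3 * x - 4 * 1 * y) / 5) ^ 2
      + Complex.normSq ((3 * x - 4 * (-1) * y) / 5) ^ 2
      + Complex.normSq ((3 * x - 4 * Complex.I * y) / 5) ^ 2
      + Complex.normSq ((3 * x - 4 * (-Complex.I) * y) / 5) ^ 2) * z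
      = 4 / 625 * 81 * (Complex.normSq x ^ 2 * z)
        + 4 / 625 * 576 * (Complex.normSq x * Complex.normSq y * z)
        + 4 / 625 * 256 * (Complex.normSq y ^ 2 * z) := by
    simp [Complex.normSq_apply]
    ring
  have h21 (i : Fin d) (c : ℝ) : Integrable (fun U : Matrix.unitaryGroup (Fin d) ℂ =>
      c * (Complex.normSq (U.1 i s) ^ 2 * Complex.normSq (U.1 r s))) μ :=
    Continuous.integrable_unitaryGroup (continuous_const.mul (((hc i).pow 2).mul (hc r)))
  have h111 (c : ℝ) : Integrable (fun U : Matrix.unitaryGroup (Fin d) ℂ =>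
      c * (Complex.normSq (U.1 p s) * Complex.normSq (U.1 q s) * Complex.normSq (U.1 r s))) μ :=
    Continuous.integrable_unitaryGroup (continuous_const.mul (((hc p).mul (hc q)).mul (hc r)))
  simp only [Function.comp_def, hpt] at h
  rw [integral_add ((h21 _ _).fun_add (h111 _)) (h21 _ _), integral_add (h21 _ _) (h111 _)] at h
  simp only [integral_const_mul] at h
  have e3 := integral_eq_of_swap μ hpq s fun x _ => Complex.normSq x ^ 3
  have ep := integral_normSq_pow_three_eq μ hpr s
  have eq := integral_normSq_pow_three_eq μ hqr s
  linarith

/-- The moment of order `(3, 3)` of the entries of column `s` of a random unitary matrix. -/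
noncomputable def columnMoment (s : Fin d) (a b : Fin 3 → Fin d) : ℂ :=
  ∫ U, (∏ k, U.1 (a k) s) * star (∏ k, U.1 (b k) s) ∂μ

theorem exists_perm_of_card_filter_eq {ι α : Type*} [Fintype ι] [DecidableEq α] {a b : ι → α}
    (h : ∀ i, (Finset.univ.filter fun k => a k = i).card
      = (Finset.univ.filter fun k => b k = i).card) :
    ∃ π : Equiv.Perm ι, ∀ k, a (π k) = b k := by
  classical
  have e (i : α) : {k // b k = i} ≃ {k // a k = i} :=
    Fintype.equivOfCardEq (by simp [Fintype.card_subtype, h i])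
  exact ⟨Equiv.ofFiberEquiv e, Equiv.ofFiberEquiv_map e⟩

theorem columnMoment_eq_zero [μ.IsMulLeftInvariant] (s : Fin d) {a b : Fin 3 → Fin d}
    (h : ∀ π : Equiv.Perm (Fin 3), ¬ ∀ k, a (π k) = b k) : columnMoment μ s a b = 0 := by
  contrapose! h
  refine exists_perm_of_card_filter_eq fun i => ?_
  set p := (Finset.univ.filter fun k => a k = i).card with hp
  set q := (Finset.univ.filter fun k => b k = i).card with hq
  let D : Matrix (Fin d) (Fin d) ℂ := diagonal fun j => if j = i then Complex.I else 1
  have hD : D ∈ Matrix.unitaryGroup (Fin d) ℂ := by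
    rw [Matrix.mem_unitaryGroup_iff, Matrix.star_eq_conjTranspose, diagonal_conjTranspose,
      diagonal_mul_diagonal, ← diagonal_one]
    congr 1
    ext j
    by_cases hj : j = i <;> simp [hj]
  have hmul : Complex.I ^ p * (-Complex.I) ^ q * columnMoment μ s a b = columnMoment μ s a b := by
    conv_rhs => rw [columnMoment, ← integral_mul_left_eq_self _ (⟨D, hD⟩ : unitaryGroup (Fin d) ℂ)]
    rw [columnMoment, ← integral_const_mul]
    refine integral_congr_ae (.of_forall fun U => ?_)
    have hentry (c : Fin 3 → Fin d) : ∏ k, ((⟨D, hD⟩ : unitaryGroup (Fin d) ℂ) * U).1 (c k) s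
        = Complex.I ^ (Finset.univ.filter fun k => c k = i).card * ∏ k, U.1 (c k) s := by
      have (j : Fin d) : ((⟨D, hD⟩ : unitaryGroup (Fin d) ℂ) * U).1 j s
          = (if j = i then Complex.I else 1) * U.1 j s := by
        simp [D, diagonal_mul]
      simp only [this, Finset.prod_mul_distrib, Finset.prod_ite, Finset.prod_const, one_pow,
        mul_one]
    simp only [hentry, ← hp, ← hq]
    simp only [star_mul', star_pow, Complex.star_def, Complex.conj_I]
    ring
  have hpow : Complex.I ^ p * (-Complex.I) ^ q = 1 := mul_right_cancel₀ h (by rw [hmul, one_mul])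
  have hp3 : p ≤ 3 := (Finset.card_le_univ _).trans (by simp)
  have hq3 : q ≤ 3 := (Finset.card_le_univ _).trans (by simp)
  clear_value p q
  interval_cases p <;> interval_cases q <;>
    first
    | rfl
    | (exfalso; norm_num [pow_succ, Complex.ext_iff] at hpow)

theorem columnMoment_self (s : Fin d) (a : Fin 3 → Fin d) :
    columnMoment μ s a a = ((∫ U, Complex.normSq (U.1 (a 0) s) * Complex.normSq (U.1 (a 1) s)
      * Complex.normSq (U.1 (a 2) s) ∂μ : ℝ) : ℂ) := by
  rw [columnMoment, ← integral_complex_ofReal]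
  refine integral_congr_ae (.of_forall fun U => ?_)
  simp only [Complex.star_def, map_mul, Fin.prod_univ_three, Complex.ofReal_mul,
    Complex.normSq_eq_conj_mul_self]
  ring

theorem columnMoment_perm (s : Fin d) {a b : Fin 3 → Fin d} {π : Equiv.Perm (Fin 3)}
    (h : ∀ k, a (π k) = b k) : columnMoment μ s a b = columnMoment μ s a a := by
  have (U : unitaryGroup (Fin d) ℂ) : ∏ k, U.1 (b k) s = ∏ k, U.1 (a k) s := by
    simp only [← h]
    exact Equiv.prod_comp π fun k => U.1 (a k) s
  simp only [columnMoment, this]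

theorem sum_permOp3_apply (a b : Fin 3 → Fin d) :
    ∑ π, permOp3 π a b = permOp3 1 a b + permOp3 (Equiv.swap 0 1) a b
      + permOp3 (Equiv.swap 0 2) a b + permOp3 (Equiv.swap 1 2) a b
      + permOp3 (finRotate 3) a b + permOp3 (finRotate 3)⁻¹ a b := by
  have : (Finset.univ : Finset (Equiv.Perm (Fin 3))) = {1, Equiv.swap 0 1, Equiv.swap 0 2,
      Equiv.swap 1 2, finRotate 3, (finRotate 3)⁻¹} := by decide
  rw [this]
  rw [Finset.sum_insert (by decide), Finset.sum_insert (by decide), Finset.sum_insert (by decide),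
    Finset.sum_insert (by decide), Finset.sum_insert (by decide), Finset.sum_singleton]
  ring

theorem permOp3_entries (a b : Fin 3 → Fin d) :
    (permOp3 1 a b = if a 0 = b 0 ∧ a 1 = b 1 ∧ a 2 = b 2 then 1 else 0) ∧
    (permOp3 (Equiv.swap 0 1) a b = if a 1 = b 0 ∧ a 0 = b 1 ∧ a 2 = b 2 then 1 else 0) ∧
    (permOp3 (Equiv.swap 0 2) a b = if a 2 = b 0 ∧ a 1 = b 1 ∧ a 0 = b 2 then 1 else 0) ∧
    (permOp3 (Equiv.swap 1 2) a b = if a 0 = b 0 ∧ a 2 = b 1 ∧ a 1 = b 2 then 1 else 0) ∧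
    (permOp3 (finRotate 3) a b = if a 1 = b 0 ∧ a 2 = b 1 ∧ a 0 = b 2 then 1 else 0) ∧
    (permOp3 (finRotate 3)⁻¹ a b = if a 2 = b 0 ∧ a 0 = b 1 ∧ a 1 = b 2 then 1 else 0) := by
  have h02 : Equiv.swap (0 : Fin 3) 1 2 = 2 := by decide
  have h11 : Equiv.swap (0 : Fin 3) 2 1 = 1 := by decide
  have h00 : Equiv.swap (1 : Fin 3) 2 0 = 0 := by decide
  have r0 : (finRotate 3)⁻¹ 0 = 2 := by decide
  have r1 : (finRotate 3)⁻¹ 1 = 0 := by decide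
  have r2 : (finRotate 3)⁻¹ 2 = 1 := by decide
  have s0 : finRotate 3 0 = 1 := by decide
  have s1 : finRotate 3 1 = 2 := by decide
  have s2 : finRotate 3 2 = 0 := by decide
  have hall (P : Fin 3 → Prop) : (∀ k, P k) ↔ P 0 ∧ P 1 ∧ P 2 := by
    simp [Fin.forall_fin_succ]
  simp only [permOp3, Matrix.of_apply, hall, Equiv.Perm.one_apply, Equiv.swap_apply_left,
    Equiv.swap_apply_right, h02, h11, h00, r0, r1, r2, s0, s1, s2, true_and]

theorem exists_columnMoment_eq [μ.IsMulLeftInvariant] [IsFiniteMeasure μ] (s : Fin d) :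
    ∃ C : ℂ, ∀ a b : Fin 3 → Fin d, columnMoment μ s a b = C * ∑ π, permOp3 π a b := by
  let C : ℝ := (∫ U, Complex.normSq (U.1 s s) ^ 3 ∂μ) / 6
  have h3 (p : Fin d) : ∫ U, Complex.normSq (U.1 p s) ^ 3 ∂μ = 6 * C := by
    by_cases hp : p = s
    · subst hp
      simp only [C]
      ring
    · rw [integral_eq_of_swap μ hp s fun x _ => Complex.normSq x ^ 3]
      simp only [C]
      ring
  have h21 {p q : Fin d} (hpq : p ≠ q) :
      ∫ U, Complex.normSq (U.1 p s) ^ 2 * Complex.normSq (U.1 q s) ∂μ = 2 * C := by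
    linarith [h3 p, integral_normSq_pow_three_eq μ hpq s]
  have h111 {p q r : Fin d} (hpq : p ≠ q) (hpr : p ≠ r) (hqr : q ≠ r) :
      ∫ U, Complex.normSq (U.1 p s) * Complex.normSq (U.1 q s) * Complex.normSq (U.1 r s) ∂μ
        = C := by
    linarith [h21 hpr, integral_normSq_sq_mul_eq μ hpq hpr hqr s]
  have hself (a : Fin 3 → Fin d) : columnMoment μ s a a = C * ∑ π, permOp3 π a a := by
    rw [columnMoment_self, sum_permOp3_apply]
    obtain ⟨e1, e2, e3, e4, e5, e6⟩ := permOp3_entries a a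
    rw [e1, e2, e3, e4, e5, e6]
    generalize a 0 = x, a 1 = y, a 2 = z
    by_cases hxy : x = y
    · subst hxy
      by_cases hxz : x = z
      · subst hxz
        have := h3 x
        simp only [pow_succ, pow_zero, one_mul] at this
        rw [this]
        simp
        ring
      · have := h21 hxz
        simp only [pow_succ, pow_zero, one_mul] at this
        rw [this]
        simp [hxz, Ne.symm hxz]
        ring
    · by_cases hxz : x = z
      · subst hxz
        have := h21 hxy
        simp only [pow_succ, pow_zero, one_mul] at this
        simp only [mul_right_comm _ (Complex.normSq (_ : ℂ)) (Complex.normSq (_ : ℂ))]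
        rw [this]
        simp [hxy, Ne.symm hxy]
        ring
      · by_cases hyz : y = z
        · subst hyz
          have := h21 (Ne.symm hxy)
          simp only [pow_succ, pow_zero, one_mul] at this
          simp only [mul_assoc, mul_comm (Complex.normSq ((_ : Matrix _ _ ℂ) x s))] at this ⊢
          rw [this]
          simp [hxy, Ne.symm hxy]
          ring
        · rw [h111 hxy hxz hyz]
          simp [hxy, hxz, hyz, Ne.symm hxy, Ne.symm hxz, Ne.symm hyz]
  refine ⟨C, fun a b => ?_⟩
  by_cases h : ∃ π : Equiv.Perm (Fin 3), ∀ k, a (π k) = b k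
  · obtain ⟨π, hπ⟩ := h
    rw [columnMoment_perm μ s hπ, hself]
    congr 1
    refine Fintype.sum_equiv (Equiv.mulRight π) _ _ fun σ => ?_
    simp only [permOp3, Matrix.of_apply, ← hπ, Equiv.coe_mulRight, Equiv.Perm.mul_apply]
    exact if_congr (π.forall_congr_right (q := fun k => a (σ k) = a k)).symm rfl rfl
  · push Not at h
    rw [columnMoment_eq_zero μ s fun π hπ => (h π).elim fun k hk => hk (hπ k)]
    rw [Finset.sum_eq_zero, mul_zero]
    intro π _
    simpa [permOp3] using h π

theorem unitaryGroup_sum_mul_star (U : Matrix.unitaryGroup (Fin d) ℂ) (i j : Fin d) :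
    ∑ s, U.1 i s * star (U.1 j s) = if i = j then 1 else 0 := by
  have h := congrFun₂ (Matrix.mem_unitaryGroup_iff.mp U.2) i j
  simpa [Matrix.mul_apply, Matrix.one_apply] using h

theorem unitaryGroup_sum_star_mul (U : Matrix.unitaryGroup (Fin d) ℂ) (s : Fin d) :
    ∑ i, U.1 i s * star (U.1 i s) = 1 := by
  have h := congrFun₂ (Matrix.mem_unitaryGroup_iff'.mp U.2) s s
  simpa [Matrix.mul_apply, mul_comm] using h

theorem integral_pair_eq_sum_columnMoment [IsFiniteMeasure μ] (s i j k l : Fin d) :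
    ∫ U, U.1 i s * U.1 j s * star (U.1 k s * U.1 l s) ∂μ
      = ∑ c, columnMoment μ s ![i, j, c] ![k, l, c] := by
  have hc := fun i => continuous_unitaryGroup_entry (d := d) i s
  simp only [columnMoment, Fin.prod_univ_three]
  rw [← integral_finsetSum]
  · refine integral_congr_ae (.of_forall fun U => ?_)
    have h := unitaryGroup_sum_star_mul U s
    calc _ = U.1 i s * U.1 j s * star (U.1 k s * U.1 l s) * ∑ c, U.1 c s * star (U.1 c s) := by
          rw [h, mul_one]
      _ = _ := by
          rw [Finset.mul_sum]
          refine Finset.sum_congr rfl fun c _ => ?_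
          simp
          ring
  · intro c _
    refine Continuous.integrable_unitaryGroup (.mul ?_ (.star ?_)) <;>
      exact ((hc _).mul (hc _)).mul (hc _)

theorem sum_sum_permOp3 (i j k l : Fin d) :
    ∑ c, ∑ π, permOp3 π ![i, j, c] ![k, l, c] = ((d : ℂ) + 2) *
      ((if i = k ∧ j = l then 1 else 0) + if j = k ∧ i = l then 1 else 0) := by
  have hsum (x : Fin d) (P : Prop) [Decidable P] :
      ∑ c, (if c = x ∧ P then 1 else 0) = if P then (1 : ℂ) else 0 := by
    simp [ite_and]
  have e3 (c : Fin d) : (c = k ∧ j = l ∧ i = c) ↔ (c = i ∧ i = k ∧ j = l) := by grind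
  have e4 (c : Fin d) : (i = k ∧ c = l ∧ j = c) ↔ (c = j ∧ i = k ∧ j = l) := by grind
  have e5 (c : Fin d) : (j = k ∧ c = l ∧ i = c) ↔ (c = i ∧ j = k ∧ i = l) := by grind
  have e6 (c : Fin d) : (c = k ∧ i = l ∧ j = c) ↔ (c = j ∧ j = k ∧ i = l) := by grind
  simp only [sum_permOp3_apply, permOp3_entries, Finset.sum_add_distrib, Matrix.cons_val, e3, e4,
    e5, e6, hsum, and_true, Finset.sum_const, Finset.card_univ, Fintype.card_fin, nsmul_eq_mul]
  ring

theorem columnMoment_eq [μ.IsMulLeftInvariant] [IsProbabilityMeasure μ]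
    (s : Fin d) (a b : Fin 3 → Fin d) :
    columnMoment μ s a b = ((d : ℂ) * (d + 1) * (d + 2))⁻¹ * ∑ π, permOp3 π a b := by
  obtain ⟨C, hC⟩ := exists_columnMoment_eq μ s
  have hc := fun i => continuous_unitaryGroup_entry (d := d) i s
  have h1 : ∑ i, ∑ j, ∫ U, U.1 i s * U.1 j s * star (U.1 i s * U.1 j s) ∂μ = 1 := by
    have hint (i j : Fin d) :
        Integrable (fun U : unitaryGroup (Fin d) ℂ =>
          U.1 i s * U.1 j s * star (U.1 i s * U.1 j s)) μ := by
      refine Continuous.integrable_unitaryGroup (.mul ?_ (.star ?_)) <;> exact (hc _).mul (hc _)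
    calc _ = ∫ U, ∑ i, ∑ j, U.1 i s * U.1 j s * star (U.1 i s * U.1 j s) ∂μ := by
          rw [integral_finsetSum _ fun i _ => integrable_finsetSum _ fun j _ => hint i j]
          refine Finset.sum_congr rfl fun i _ => ?_
          rw [integral_finsetSum _ fun j _ => hint i j]
      _ = ∫ U, (1 : ℂ) ∂μ := by
          refine integral_congr_ae (.of_forall fun U => ?_)
          have h := unitaryGroup_sum_star_mul U s
          calc _ = (∑ i, U.1 i s * star (U.1 i s)) * ∑ j, U.1 j s * star (U.1 j s) := by
                rw [Finset.sum_mul_sum]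
                refine Finset.sum_congr rfl fun i _ => Finset.sum_congr rfl fun j _ => ?_
                simp only [star_mul']
                ring
            _ = 1 := by rw [h, one_mul]
      _ = 1 := by simp
  have h2 : C * ((d : ℂ) * (d + 1) * (d + 2)) = 1 := by
    refine Eq.trans ?_ h1
    simp only [integral_pair_eq_sum_columnMoment, hC, ← Finset.mul_sum, sum_sum_permOp3]
    simp [Finset.sum_add_distrib, ite_and, -mul_eq_mul_left_iff]
    ring
  rw [hC, eq_inv_of_mul_eq_one_left h2]

theorem integral_pair_eq [μ.IsMulLeftInvariant] [IsProbabilityMeasure μ] (s i j k l : Fin d) :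
    ∫ U, U.1 i s * U.1 j s * star (U.1 k s * U.1 l s) ∂μ
      = ((d : ℂ) * (d + 1))⁻¹ *
        ((if i = k ∧ j = l then 1 else 0) + if j = k ∧ i = l then 1 else 0) := by
  have hd : (d : ℂ) + 2 ≠ 0 := by exact_mod_cast (by omega : d + 2 ≠ 0)
  rw [integral_pair_eq_sum_columnMoment]
  simp only [columnMoment_eq, ← Finset.mul_sum, sum_sum_permOp3]
  rw [mul_inv _ ((d : ℂ) + 2), ← mul_assoc, inv_mul_cancel_right₀ hd]

theorem sum_fin_three_arrow {α M : Type*} [Fintype α] [AddCommMonoid M] (f : α → α → α → M) :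
    ∑ s : Fin 3 → α, f (s 0) (s 1) (s 2) = ∑ p, ∑ q, ∑ r, f p q r := by
  let e : (Fin 3 → α) ≃ α × α × α :=
    { toFun := fun s => (s 0, s 1, s 2)
      invFun := fun p => ![p.1, p.2.1, p.2.2]
      left_inv := fun s => by ext k; fin_cases k <;> rfl
      right_inv := fun _ => rfl }
  simp only [← Fintype.sum_prod_type']
  exact e.sum_comp fun p => f p.1 p.2.1 p.2.2

theorem tpow3_mul_diagonal_mul_conjTranspose_apply (U : Matrix.unitaryGroup (Fin d) ℂ)
    (a b : Fin 3 → Fin d) :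
    (tpow3 (U : Matrix (Fin d) (Fin d) ℂ) *
        Matrix.diagonal (fun s : Fin 3 → Fin d => x2coef d (s 0) (s 1) * x2coef d (s 0) (s 2)) *
        (tpow3 (U : Matrix (Fin d) (Fin d) ℂ))ᴴ) a b =
      ((d : ℂ) + 1) ^ 2 * ∑ s, (∏ k, U.1 (a k) s) * star (∏ k, U.1 (b k) s)
      - (d + 1) * ((if a 2 = b 2 then 1 else 0) *
          ∑ s, U.1 (a 0) s * U.1 (a 1) s * star (U.1 (b 0) s * U.1 (b 1) s))
      - (d + 1) * ((if a 1 = b 1 then 1 else 0) *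
          ∑ s, U.1 (a 0) s * U.1 (a 2) s * star (U.1 (b 0) s * U.1 (b 2) s))
      + (if a 0 = b 0 then 1 else 0) * (if a 1 = b 1 then 1 else 0) *
          (if a 2 = b 2 then 1 else 0) := by
  let g (k : Fin 3) (s : Fin d) : ℂ := U.1 (a k) s * star (U.1 (b k) s)
  have hg (k : Fin 3) : ∑ s, g k s = if a k = b k then 1 else 0 :=
    unitaryGroup_sum_mul_star U (a k) (b k)
  have hx (s t : Fin d) : x2coef d s t = (d + 1) * (if s = t then 1 else 0) - 1 := by
    unfold x2coef
    split_ifs <;> ring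
  have hlhs : (tpow3 (U : Matrix (Fin d) (Fin d) ℂ) *
        Matrix.diagonal (fun s : Fin 3 → Fin d => x2coef d (s 0) (s 1) * x2coef d (s 0) (s 2)) *
        (tpow3 (U : Matrix (Fin d) (Fin d) ℂ))ᴴ) a b
      = ∑ p, ∑ q, ∑ r, x2coef d p q * x2coef d p r * (g 0 p * g 1 q * g 2 r) := by
    rw [← sum_fin_three_arrow, Matrix.mul_apply]
    refine Finset.sum_congr rfl fun s _ => ?_
    simp only [Matrix.mul_diagonal, Matrix.conjTranspose_apply, tpow3, Matrix.of_apply,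
      Fin.prod_univ_three, star_mul', g]
    ring
  have hinner (p : Fin d) : ∑ q, ∑ r, x2coef d p q * x2coef d p r * (g 0 p * g 1 q * g 2 r)
      = g 0 p * ((d + 1) * g 1 p - ∑ q, g 1 q) * ((d + 1) * g 2 p - ∑ r, g 2 r) := by
    have hk (k : Fin 3) : (d + 1) * g k p - ∑ q, g k q = ∑ q, x2coef d p q * g k q := by
      simp [hx, sub_mul, Finset.sum_sub_distrib]
    rw [hk, hk, mul_assoc, Finset.sum_mul_sum, Finset.mul_sum]
    refine Finset.sum_congr rfl fun q _ => ?_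
    rw [Finset.mul_sum]
    exact Finset.sum_congr rfl fun r _ => by ring
  rw [hlhs]
  simp only [hinner, ← hg]
  have e3 (s : Fin d) : (∏ k, U.1 (a k) s) * star (∏ k, U.1 (b k) s)
      = g 0 s * g 1 s * g 2 s := by
    simp only [g, Fin.prod_univ_three, star_mul']
    ring
  have e2 (k l : Fin 3) (s : Fin d) :
      U.1 (a k) s * U.1 (a l) s * star (U.1 (b k) s * U.1 (b l) s) = g k s * g l s := by
    simp only [g, star_mul']
    ring
  simp only [e3, e2]
  generalize hA : ∑ s, g 1 s = A
  generalize hB : ∑ s, g 2 s = B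
  simp only [Finset.mul_sum, Finset.sum_mul, ← Finset.sum_sub_distrib, ← Finset.sum_add_distrib]
  exact Finset.sum_congr rfl fun s _ => by ring

end ColumnMoments

/-- Third-order twirling of the diagonal matrix with entries
`x₂(s₁,s₂)·x₂(s₁,s₃)`: for Haar-random `U ∈ U(d)`,
`∫ U^{⊗3} X (U^{⊗3})† dμ = −(1/(d+2))(P_id + P₍₁₂₎ + P₍₁₃₎) + ((d+1)/(d+2))(P₍₂₃₎ + P₍₁₂₃₎ + P₍₁₃₂₎)`
(entrywise). -/
theorem twirl_X2X2_eq_perm_combo {d : ℕ} (hd : 1 ≤ d)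
    (μ : Measure (Matrix.unitaryGroup (Fin d) ℂ))
    [μ.IsHaarMeasure] [IsProbabilityMeasure μ] :
    ∀ a b : Fin 3 → Fin d,
      (∫ U : Matrix.unitaryGroup (Fin d) ℂ,
        ((tpow3 (U : Matrix (Fin d) (Fin d) ℂ) *
          Matrix.diagonal (fun s : Fin 3 → Fin d => x2coef d (s 0) (s 1) * x2coef d (s 0) (s 2)) *
          (tpow3 (U : Matrix (Fin d) (Fin d) ℂ))ᴴ) a b) ∂μ) =
      (((-(1 / ((d : ℂ) + 2))) •
          (permOp3 (1 : Equiv.Perm (Fin 3)) + permOp3 (Equiv.swap 0 1) + permOp3 (Equiv.swap 0 2)) +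
        (((d : ℂ) + 1) / ((d : ℂ) + 2)) •
          (permOp3 (Equiv.swap 1 2) + permOp3 (finRotate 3) + permOp3 (finRotate 3)⁻¹) :
        Matrix (Fin 3 → Fin d) (Fin 3 → Fin d) ℂ) a b) := by
  intro a b
  have hd0 : (d : ℂ) ≠ 0 := by exact_mod_cast (by omega : d ≠ 0)
  have hd1 : (d : ℂ) + 1 ≠ 0 := by exact_mod_cast (by omega : d + 1 ≠ 0)
  have hd2 : (d : ℂ) + 2 ≠ 0 := by exact_mod_cast (by omega : d + 2 ≠ 0)
  have hc (i s : Fin d) := continuous_unitaryGroup_entry i s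
  have hpair (i j k l s : Fin d) : Continuous fun U : unitaryGroup (Fin d) ℂ =>
      U.1 i s * U.1 j s * star (U.1 k s * U.1 l s) :=
    ((hc _ _).mul (hc _ _)).mul ((hc _ _).mul (hc _ _)).star
  have htriple (s : Fin d) : Continuous fun U : unitaryGroup (Fin d) ℂ =>
      (∏ k, U.1 (a k) s) * star (∏ k, U.1 (b k) s) :=
    (continuous_finsetProd _ fun _ _ => hc _ _).mul
      (continuous_finsetProd _ fun _ _ => hc _ _).star
  have h2 (i j k l : Fin d) (z : ℂ) : Continuous fun U : unitaryGroup (Fin d) ℂ =>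
      ((d : ℂ) + 1) * (z * ∑ s, U.1 i s * U.1 j s * star (U.1 k s * U.1 l s)) :=
    continuous_const.mul (continuous_const.mul (continuous_finsetSum _ fun s _ => hpair i j k l s))
  have h3 : Continuous fun U : unitaryGroup (Fin d) ℂ =>
      ((d : ℂ) + 1) ^ 2 * ∑ s, (∏ k, U.1 (a k) s) * star (∏ k, U.1 (b k) s) :=
    continuous_const.mul (continuous_finsetSum _ fun s _ => htriple s)
  have hi {f : unitaryGroup (Fin d) ℂ → ℂ} (hf : Continuous f) : Integrable f μ :=
    hf.integrable_unitaryGroup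
  have hs {f g : unitaryGroup (Fin d) ℂ → ℂ} (hf : Integrable f μ) (hg : Integrable g μ) :
      Integrable (fun U => f U - g U) μ := hf.sub hg
  simp only [tpow3_mul_diagonal_mul_conjTranspose_apply]
  rw [integral_add (hs (hs (hi h3) (hi (h2 _ _ _ _ _))) (hi (h2 _ _ _ _ _))) (integrable_const _),
    integral_sub (hs (hi h3) (hi (h2 _ _ _ _ _))) (hi (h2 _ _ _ _ _)),
    integral_sub (hi h3) (hi (h2 _ _ _ _ _))]
  simp only [integral_const_mul]
  rw [integral_finsetSum _ fun s _ => hi (htriple s),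
    integral_finsetSum _ fun s _ => hi (hpair _ _ _ _ s),
    integral_finsetSum _ fun s _ => hi (hpair _ _ _ _ s)]
  have e3 (s : Fin d) : ∫ U, (∏ k, U.1 (a k) s) * star (∏ k, U.1 (b k) s) ∂μ
      = ((d : ℂ) * (d + 1) * (d + 2))⁻¹ * ∑ π, permOp3 π a b := columnMoment_eq μ s a b
  simp only [e3, integral_pair_eq, Finset.sum_const, Finset.card_univ, Fintype.card_fin,
    nsmul_eq_mul, integral_const, probReal_univ, one_smul]
  have p1 : (permOp3 1 a b : ℂ) = (if a 0 = b 0 then 1 else 0) * (if a 1 = b 1 then 1 else 0) *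
      (if a 2 = b 2 then 1 else 0) := by
    rw [(permOp3_entries a b).1]
    split_ifs <;> simp_all
  have p01 : (permOp3 1 a b : ℂ) + permOp3 (Equiv.swap 0 1) a b = (if a 2 = b 2 then 1 else 0) *
      ((if a 0 = b 0 ∧ a 1 = b 1 then 1 else 0) + if a 1 = b 0 ∧ a 0 = b 1 then 1 else 0) := by
    rw [(permOp3_entries a b).1, (permOp3_entries a b).2.1]
    by_cases h : a 2 = b 2 <;> simp [h]
  have p02 : (permOp3 1 a b : ℂ) + permOp3 (Equiv.swap 0 2) a b = (if a 1 = b 1 then 1 else 0) *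
      ((if a 0 = b 0 ∧ a 2 = b 2 then 1 else 0) + if a 2 = b 0 ∧ a 0 = b 2 then 1 else 0) := by
    rw [(permOp3_entries a b).1, (permOp3_entries a b).2.2.1]
    by_cases h : a 1 = b 1 <;> simp [h]
  have hcancel (z w : ℂ) : ((d : ℂ) + 1) * (z * (d * (((d : ℂ) * (d + 1))⁻¹ * w))) = z * w := by
    field_simp
  rw [hcancel, hcancel, ← p1, ← p01, ← p02, sum_permOp3_apply]
  simp only [Matrix.add_apply, Matrix.smul_apply, smul_eq_mul]
  field_simp
  ring
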